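/- arXiv:2111.03369 — 3 statements merged into one kernel-verified Lean document; each statement's English description precedes it below -/
import Mathlib

section
/- For all integers with 1 ≤ m ≤ l < n and every integer r with 0 ≤ r ≤ 2l−2m+2, the polynomial K_q(n,m)·K_q(n,l) − q^r·K_q(n,m−1)·K_q(n,l+1) has nonnegative coefficients as a polynomial in q. -/
open Polynomial Finset

/-- The Gaussian polynomial `[n m]_q`, as a polynomial in `ℤ[q]`
(it vanishes when `m > n`).  It is defined by the `q`-Pascal recursion
`[n m]_q = [n-1 m-1]_q + q^m [n-1 m]_q`. -/
noncomputable def gauss : ℕ → ℕ → Polynomial ℤ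
  | _, 0 => 1
  | 0, _ + 1 => 0
  | n + 1, m + 1 => gauss n m + X ^ (m + 1) * gauss n (m + 1)

/-- The `q`-Kaplansky number `K_q(n,m) = ((1-q^(n+m))/(1-q^n))·[n m]_q`,
defined as the polynomial `[n-1 m-1]_q + q^m·[n m]_q`. -/
noncomputable def kap (n : ℕ) : ℕ → Polynomial ℤ
  | 0 => 1
  | m + 1 => gauss (n - 1) m + X ^ (m + 1) * gauss n (m + 1)

/-- The number of ones of a (0,1)-sequence. -/
def numOnes {N : ℕ} (w : Fin N → Bool) : ℕ :=
  (Finset.univ.filter fun i => w i = true).card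

/-- The inversion number of a (0,1)-sequence: the number of pairs `(i,j)`
with `i < j`, `w i = 1` and `w j = 0`. -/
def invW {N : ℕ} (w : Fin N → Bool) : ℕ :=
  ((Finset.univ : Finset (Fin N × Fin N)).filter
    fun p => p.1 < p.2 ∧ w p.1 = true ∧ w p.2 = false).card

/-- The major index of a (0,1)-sequence: the sum of the (1-based) positions `i`
with `w_i > w_(i+1)`. -/
def majW {N : ℕ} (w : Fin N → Bool) : ℕ :=
  ∑ i : Fin N,
    if h : (i : ℕ) + 1 < N then
      (if w i = true ∧ w ⟨(i : ℕ) + 1, h⟩ = false then (i : ℕ) + 1 else 0)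
    else 0

/-- Coefficientwise nonnegativity. -/
def NNc (p : Polynomial ℤ) : Prop := ∀ i, 0 ≤ p.coeff i

lemma NNc.add {p s : Polynomial ℤ} (hp : NNc p) (hs : NNc s) : NNc (p + s) := fun i => by
  rw [coeff_add]; exact add_nonneg (hp i) (hs i)

lemma NNc.mul {p s : Polynomial ℤ} (hp : NNc p) (hs : NNc s) : NNc (p * s) := fun i => by
  rw [coeff_mul]; exact Finset.sum_nonneg fun x _ => mul_nonneg (hp _) (hs _)

lemma NNc.zero : NNc 0 := fun i => by simp

lemma NNc.one : NNc 1 := fun i => by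
  rw [coeff_one]; split_ifs <;> simp

lemma NNc.xpow (k : ℕ) : NNc (X ^ k) := fun i => by
  rw [coeff_X_pow]; split_ifs <;> simp

lemma gauss_zero_right (n : ℕ) : gauss n 0 = 1 := by cases n <;> simp [gauss]

lemma gauss_nn : ∀ n m, NNc (gauss n m)
  | n, 0 => by rw [gauss_zero_right]; exact NNc.one
  | 0, m + 1 => by simp only [gauss]; exact NNc.zero
  | n + 1, m + 1 => by
    simp only [gauss]
    exact (gauss_nn n m).add ((NNc.xpow _).mul (gauss_nn n (m + 1)))

lemma gauss_big : ∀ n m, n < m → gauss n m = 0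
  | n, 0, h => by omega
  | 0, m + 1, _ => by simp only [gauss]
  | n + 1, m + 1, h => by
    simp only [gauss]
    rw [gauss_big n m (by omega), gauss_big n (m + 1) (by omega)]; simp

/-- shifted Gaussian polynomial: `gs n j = [n, j-1]` -/
noncomputable def gs (n : ℕ) : ℕ → Polynomial ℤ
  | 0 => 0
  | j + 1 => gauss n j

lemma gs_nn (n j : ℕ) : NNc (gs n j) := by
  cases j
  · exact NNc.zero
  · exact gauss_nn _ _

lemma gs_rec (n j : ℕ) : gs (n + 1) (j + 1) = gs n j + X ^ j * gs n (j + 1) := by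
  cases j with
  | zero => simp [gs, gauss_zero_right]
  | succ j => simp [gs, gauss]

lemma gs_rec' : ∀ n j e : ℕ, j + e = n + 1 →
    gs (n + 1) (j + 1) = X ^ e * gs n j + gs n (j + 1) := by
  intro n
  induction n with
  | zero =>
    intro j e h
    rcases j with _ | _ | j
    · simp [gs, gauss_zero_right]
    · have : e = 0 := by omega
      subst this
      simp [gs, gauss]
    · omega
  | succ n ih =>
    intro j e h
    rcases j with _ | j
    · simp [gs, gauss_zero_right]
    · rw [gs_rec (n + 1) (j + 1)]
      rcases e with _ | e
      · have h1 : gs (n + 1) (j + 1 + 1) = 0 := gauss_big _ _ (by omega)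
        rw [h1]; simp
      · have i1 := ih j (e + 1) (by omega)
        have i2 := ih (j + 1) e (by omega)
        have r1 := gs_rec n j
        have r2 := gs_rec n (j + 1)
        linear_combination i1 + X ^ (j + 1) * i2 - X ^ (e + 1) * r1 - r2

lemma gauss_key : ∀ n a b r : ℕ, a ≤ b → r ≤ 2 * (b - a) →
    NNc (gs n (a + 1) * gs n b - X ^ r * (gs n a * gs n (b + 1))) := by
  intro n
  have triv0 : ∀ n b r, NNc (gs n (0 + 1) * gs n b - X ^ r * (gs n 0 * gs n (b + 1))) := by
    intro n b r
    have : gs n 0 = 0 := rfl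
    rw [this]; simpa using (gs_nn n 1).mul (gs_nn n b)
  have trivb : ∀ n a b r, n < b → NNc (gs n (a + 1) * gs n b - X ^ r * (gs n a * gs n (b + 1))) := by
    intro n a b r h
    have : gs n (b + 1) = 0 := gauss_big n b h
    rw [this]; simpa using (gs_nn n (a + 1)).mul (gs_nn n b)
  induction n with
  | zero =>
    intro a b r hab hr
    rcases a with _ | a
    · exact triv0 _ _ _
    · exact trivb _ _ _ _ (by omega)
  | succ n ih =>
    intro a b r hab hr
    rcases a with _ | a
    · exact triv0 _ _ _
    rcases hab.eq_or_lt with h | h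
    · subst h
      have : r = 0 := by omega
      subst this
      have : gs (n + 1) (a + 1 + 1) * gs (n + 1) (a + 1) -
        X ^ 0 * (gs (n + 1) (a + 1) * gs (n + 1) (a + 1 + 1)) = 0 := by ring
      rw [this]; exact NNc.zero
    by_cases hbn : n + 1 < b
    · exact trivb _ _ _ _ hbn
    obtain ⟨d, rfl⟩ : ∃ d, b = a + 1 + d + 1 := ⟨b - a - 2, by omega⟩
    obtain ⟨e, rfl⟩ : ∃ e, n = a + 1 + d + e := ⟨n - (a + 1 + d), by omega⟩
    have hr' : r ≤ 2 * d + 2 := by omega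
    clear hr
    set n := a + 1 + d + e with hn
    have A1 := gs_rec n a
    have A2 := gs_rec n (a + 1)
    have B1 := gs_rec n (a + 1 + d)
    have B2 := gs_rec n (a + 1 + d + 1)
    have A1' := gs_rec' n a (e + d + 2) (by omega)
    have A2' := gs_rec' n (a + 1) (e + d + 1) (by omega)
    have B1' := gs_rec' n (a + 1 + d) (e + 1) (by omega)
    have B2' := gs_rec' n (a + 1 + d + 1) e (by omega)
    have I1 := fun r h => ih a (a + 1 + d) r (by omega) h
    have I2 := fun r h => ih (a + 1) (a + 1 + d + 1) r (by omega) h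
    have I3 := fun r h => ih a (a + 1 + d + 1) r (by omega) h
    have I4 := fun r h => ih (a + 1) (a + 1 + d) r (by omega) h
    rcases Nat.eq_zero_or_pos r with h0 | h0
    · subst h0
      have := ((((NNc.xpow (e + d + 1)).mul (I1 1 (by omega))).add
        ((NNc.xpow (e + d + 1 + (a + 1 + d))).mul (I3 2 (by omega)))).add (I4 0 (by omega))).add
        ((NNc.xpow (a + 1 + d)).mul (I2 1 (by omega)))
      rw [A1', A2', B1, B2]
      convert this using 1
      ring
    rcases hr'.eq_or_lt with h1 | h1
    · subst h1
      have := ((((NNc.xpow (e + 1)).mul (I1 (2 * d + 1) (by omega))).add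
        (I3 (2 * d + 2) (by omega))).add
        ((NNc.xpow (a + 1 + e + 1)).mul (I4 (2 * d) (by omega)))).add
        ((NNc.xpow (a + 1)).mul (I2 (2 * d + 1) (by omega)))
      rw [A1, A2, B1', B2']
      convert this using 1
      ring
    · obtain ⟨s, rfl⟩ : ∃ s, r = s + 1 := ⟨r - 1, by omega⟩
      have := (((I1 (s + 1) (by omega)).add
        ((NNc.xpow (a + 1 + (a + 1 + d))).mul (I2 (s + 1) (by omega)))).add
        ((NNc.xpow (a + 1 + d)).mul (I3 (s + 2) (by omega)))).add
        ((NNc.xpow (a + 1)).mul (I4 s (by omega)))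
      rw [A1, A2, B1, B2]
      convert this using 1
      ring

lemma kap_eq (N m : ℕ) : kap (N + 1) m = gs N m + X ^ m * gs (N + 1) (m + 1) := by
  cases m with
  | zero => simp [kap, gs, gauss_zero_right]
  | succ m => simp [kap, gs]

lemma kap_eq' (N m : ℕ) (h : m ≤ N + 1) :
    kap (N + 1) m = gs (N + 1) (m + 1) + X ^ (N + 1) * gs N m := by
  obtain ⟨e, he⟩ := Nat.exists_eq_add_of_le h
  have h1 := gs_rec N m
  have h2 := gs_rec' N m e he.symm
  have h3 : (X : Polynomial ℤ) ^ (N + 1) = X ^ m * X ^ e := by rw [he, pow_add]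
  rw [kap_eq, h3]
  linear_combination (-1 : Polynomial ℤ) * h1 + X ^ m * h2

theorem kaplansky_strong_q_log_concave_shift (n m l r : ℕ)
    (hm : 1 ≤ m) (hml : m ≤ l) (hln : l < n) (hr : r ≤ 2 * l - 2 * m + 2) :
    ∀ i, 0 ≤ (kap n m * kap n l - X ^ r * (kap n (m - 1) * kap n (l + 1))).coeff i := by
  change NNc _
  obtain ⟨a, rfl⟩ : ∃ a, m = a + 1 := ⟨m - 1, by omega⟩
  obtain ⟨d, rfl⟩ : ∃ d, l = a + 1 + d := ⟨l - (a + 1), by omega⟩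
  obtain ⟨e, rfl⟩ : ∃ e, n = a + 1 + d + e + 1 := ⟨n - (a + 1 + d) - 1, by omega⟩
  have hr' : r ≤ 2 * d + 2 := by omega
  clear hr
  rw [Nat.add_sub_cancel]
  set N := a + 1 + d + e with hN
  have A1 := gs_rec N a
  have A2 := gs_rec N (a + 1)
  have B1 := gs_rec N (a + 1 + d)
  have B2 := gs_rec N (a + 1 + d + 1)
  have A1' := gs_rec' N a (e + d + 2) (by omega)
  have A2' := gs_rec' N (a + 1) (e + d + 1) (by omega)
  have B1' := gs_rec' N (a + 1 + d) (e + 1) (by omega)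
  have B2' := gs_rec' N (a + 1 + d + 1) e (by omega)
  have I1 := fun r h => gauss_key N a (a + 1 + d) r (by omega) h
  have I2 := fun r h => gauss_key N (a + 1) (a + 1 + d + 1) r (by omega) h
  have I3 := fun r h => gauss_key N a (a + 1 + d + 1) r (by omega) h
  have I4 := fun r h => gauss_key N (a + 1) (a + 1 + d) r (by omega) h
  have J := fun r h => gauss_key (N + 1) (a + 1) (a + 1 + d + 1) r (by omega) h
  rcases Nat.eq_zero_or_pos r with h0 | h0
  · subst h0
    have C1 : NNc (gs (N + 1) (a + 1 + 1) * gs N (a + 1 + d)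
        - gs (N + 1) (a + 1) * gs N (a + 1 + d + 1)) := by
      have := ((NNc.xpow (e + d + 1)).mul (I1 1 (by omega))).add (I4 0 (by omega))
      rw [A1', A2']
      convert this using 1
      ring
    have C2 : NNc (gs N (a + 1) * gs (N + 1) (a + 1 + d + 1)
        - gs N a * gs (N + 1) (a + 1 + d + 1 + 1)) := by
      have := (I1 0 (by omega)).add ((NNc.xpow (a + 1 + d)).mul (I3 1 (by omega)))
      rw [B1, B2]
      convert this using 1
      ring
    have := ((J 0 (by omega)).add ((NNc.xpow (2 * (N + 1))).mul (I1 0 (by omega)))).add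
      ((NNc.xpow (N + 1)).mul (C1.add C2))
    rw [kap_eq' N (a + 1) (by omega), kap_eq' N (a + 1 + d) (by omega), kap_eq' N a (by omega),
      kap_eq' N (a + 1 + d + 1) (by omega)]
    convert this using 1
    ring
  rcases hr'.eq_or_lt with h1 | h1
  · subst h1
    have C1 : NNc (gs (N + 1) (a + 1 + 1) * gs N (a + 1 + d)
        - X ^ (2 * d + 1) * (gs (N + 1) (a + 1) * gs N (a + 1 + d + 1))) := by
      have := (I1 (2 * d + 1) (by omega)).add
        ((NNc.xpow (a + 1)).mul (I4 (2 * d) (by omega)))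
      rw [A1, A2]
      convert this using 1
      ring
    have C2 : NNc (gs N (a + 1) * gs (N + 1) (a + 1 + d + 1)
        - X ^ (2 * d + 3) * (gs N a * gs (N + 1) (a + 1 + d + 1 + 1))) := by
      have := ((NNc.xpow (e + 1)).mul (I1 (2 * d + 2) (by omega))).add
        (I3 (2 * d + 3) (by omega))
      rw [B1', B2']
      convert this using 1
      ring
    have := (((I1 (2 * d + 2) (by omega)).add
      ((NNc.xpow (a + 1 + (a + 1 + d))).mul (J (2 * d + 2) (by omega)))).add
      ((NNc.xpow (a + 1)).mul C1)).add ((NNc.xpow (a + 1 + d)).mul C2)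
    simp only [kap_eq]
    convert this using 1
    ring
  · obtain ⟨s, rfl⟩ : ∃ s, r = s + 1 := ⟨r - 1, by omega⟩
    have hp : NNc (1 + X ^ (N + 1)) := NNc.one.add (NNc.xpow _)
    have := (((hp.mul hp).mul (I1 (s + 1) (by omega))).add
      ((NNc.xpow (a + 1 + (a + 1 + d))).mul (I2 (s + 1) (by omega)))).add
      (hp.mul (((NNc.xpow (a + 1 + d)).mul (I3 (s + 2) (by omega))).add
        ((NNc.xpow (a + 1)).mul (I4 s (by omega)))))
    rw [kap_eq' N (a + 1) (by omega), kap_eq' N (a + 1 + d) (by omega), kap_eq' N a (by omega),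
      kap_eq' N (a + 1 + d + 1) (by omega), A1, A2, B1, B2]
    convert this using 1
    ring
end

section
/- For every even positive integer n, the polynomial ((1−q^{3n+1})/(1−q))·C_n(q) = (1+q+⋯+q^{3n})·C_n(q) is symmetric and unimodal. -/
open Polynomial Finset

lemma gauss_succ (n m : ℕ) : gauss (n+1) (m+1) = gauss n m + X ^ (m + 1) * gauss n (m + 1) := by
  simp [gauss]

lemma gauss_lt : ∀ (n m : ℕ), n < m → gauss n m = 0
  | _, 0, h => by omega
  | 0, m+1, _ => by simp [gauss]
  | n+1, m+1, h => by
    rw [gauss_succ, gauss_lt n m (by omega), gauss_lt n (m+1) (by omega)]; simp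

/-- absorption, both at once -/
lemma gauss_abs (n : ℕ) : (∀ m, (1 - X ^ (m+1)) * gauss n (m+1) = (1 - X ^ (n - m)) * gauss n m) := by
  induction n with
  | zero => intro m; simp [gauss]
  | succ n ih =>
    intro m
    rcases m with _ | m
    · have h := ih 0
      simp only [gauss_zero_right, gauss_succ] at h ⊢
      simp only [zero_add, Nat.sub_zero] at h ⊢
      linear_combination X * h
    · have h1 := ih m
      have h2 := ih (m+1)
      rw [gauss_succ, gauss_succ]
      rcases lt_or_ge n (m+1) with hlt | hge
      · rw [gauss_lt n (m+1) hlt, gauss_lt n (m+1+1) (by omega)]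
        have : n + 1 - (m+1) = 0 ∨ n = m := by omega
        simp [show n + 1 - (m+1) = 0 by omega]
      · obtain ⟨c, rfl⟩ := Nat.exists_eq_add_of_le hge
        rw [show m + 1 + c - m = c + 1 by omega] at h1
        rw [show m + 1 + c - (m+1) = c by omega] at h2
        rw [show m + 1 + c + 1 - (m+1) = c + 1 by omega]
        linear_combination X^(m+2) * h2 + h1

lemma gauss_up (n m : ℕ) (h : m ≤ n) :
    (1 - X ^ (n + 1 - m)) * gauss (n+1) m = (1 - X ^ (n+1)) * gauss n m := by
  rcases m with _ | m
  · simp [gauss_zero_right]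
  · have h1 := gauss_abs n m
    rw [gauss_succ]
    obtain ⟨c, rfl⟩ := Nat.exists_eq_add_of_le h
    rw [show m + 1 + c - m = c + 1 by omega] at h1
    rw [show m + 1 + c + 1 - (m+1) = c + 1 by omega]
    linear_combination -h1

lemma one_sub_ne (k : ℕ) : (1 - X ^ (k+1) : Polynomial ℤ) ≠ 0 := by
  intro h
  have := congrArg (Polynomial.eval 2) h
  simp at this
  have h2 : (2:ℤ)^(k+1) > 1 := one_lt_pow₀ (by norm_num) (by omega)
  omega

lemma F_eq (m : ℕ) (C : Polynomial ℤ)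
    (hC : (1 - X ^ (m + 2 + 1)) * C = (1 - X) * gauss (2 * (m+2)) (m+2))
    (F : Polynomial ℤ) (hF : F = (∑ i ∈ Finset.range (3 * (m+2) + 1), X ^ i) * C) :
    F = gauss ((m+4) + (m+2)) (m+2) - X^(m+4) * gauss ((m+4)+m) m := by
  have hg := geom_sum_mul (X : Polynomial ℤ) (3 * (m+2)+1)
  have a1 := gauss_abs (2*(m+2)) (m+1)
  have a2 := gauss_abs (2*(m+2)) m
  have u1 := gauss_up (2*(m+2)) (m+2) (by omega)
  have u2 := gauss_up (2*(m+2)+1) (m+2) (by omega)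
  rw [show 2*(m+2) - (m+1) = m + 3 by omega] at a1
  rw [show 2*(m+2) - m = m + 4 by omega] at a2
  rw [show 2*(m+2) + 1 - (m+2) = m + 3 by omega] at u1
  rw [show 2*(m+2) + 1 + 1 - (m+2) = m + 4 by omega] at u2
  rw [show m + 4 + (m+2) = 2*(m+2) + 1 + 1 by omega, show m+4+m = 2*(m+2) by omega]
  have n0 := one_sub_ne 0
  have n1 := one_sub_ne (m+2)
  have n2 := one_sub_ne (m+3)
  refine mul_left_cancel₀ n0 (mul_left_cancel₀ n1 (mul_left_cancel₀ n2 ?_))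
  rw [hF]
  generalize gauss (2*(m+2)+1+1) (m+2) = g1 at *
  generalize gauss (2*(m+2)+1) (m+2) = g2 at *
  generalize gauss (2*(m+2)) (m+2) = g at *
  generalize gauss (2*(m+2)) (m+1) = g4 at *
  generalize gauss (2*(m+2)) m = g5 at *
  generalize (∑ i ∈ Finset.range (3 * (m+2) + 1), (X:Polynomial ℤ) ^ i) = S at *
  -- (1-q)(1-aq)(1-aq^2) S C
  have e1 : (1 - X^(m+2+1)) * ((1 - X^(0+1)) * (S * C)) = (1 - X) * ((1 - X^(3*(m+2)+1)) * g) := by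
    linear_combination (-(1 - X^(m+2+1)) * C) * hg + (1 - X^(3*(m+2)+1)) * hC
  have e2 : (1 - X^(m+3+1)) * (1 - X^(m+2+1)) * g1 = (1 - X^(2*(m+2)+1+1)) * (1 - X^(2*(m+2)+1)) * g := by
    linear_combination (1 - X^(m+2+1)) * u2 + (1 - X^(2*(m+2)+1+1)) * u1
  have e3 : (1 - X^(m+3+1)) * (1 - X^(m+2+1)) * g5 = (1 - X^(m+2)) * (1 - X^(m+1)) * g := by
    linear_combination -(1 - X^(m+1)) * a1 - (1 - X^(m+2+1)) * a2
  linear_combination (1 - X^(m+3+1)) * e1 - (1 - X) * e2 + (1-X) * X^(m+4) * e3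

def cs (s k w : ℕ) : Set (Fin s → ℕ) := {d | ∑ i, d i = k ∧ ∑ i : Fin s, (i : ℕ) * d i = w}

lemma cs_fin (s k w : ℕ) : (cs s k w).Finite := by
  refine (Set.finite_Iic (fun _ : Fin s => k)).subset ?_
  rintro d ⟨h, -⟩ i
  rw [← h]
  exact Finset.single_le_sum (f := d) (fun _ _ => Nat.zero_le _) (Finset.mem_univ i)

def upf {s : ℕ} (d : Fin (s+1) → ℕ) : Fin (s+1) → ℕ := Fin.cons (d 0 + 1) (Fin.tail d)
def shf {s : ℕ} (d : Fin s → ℕ) : Fin (s+1) → ℕ := Fin.cons 0 d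

lemma upf_inj {s : ℕ} : Function.Injective (upf (s := s)) := by
  intro d e h
  have h0 := congrFun h 0
  have h1 := fun i : Fin s => congrFun h i.succ
  simp only [upf, Fin.cons_zero, Fin.cons_succ, Fin.tail] at h0 h1
  funext i
  refine Fin.cases ?_ ?_ i
  · omega
  · exact h1

lemma shf_inj {s : ℕ} : Function.Injective (shf (s := s)) := by
  intro d e h
  funext i
  have := congrFun h i.succ
  simpa [shf] using this

lemma cs_rec (s k w : ℕ) : cs (s+1) (k+1) w =
    upf '' cs (s+1) k w ∪ shf '' {d | d ∈ cs s (k+1) (w - (k+1)) ∧ k + 1 ≤ w} := by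
  ext d
  constructor
  · rintro ⟨h1, h2⟩
    rw [Fin.sum_univ_succ] at h1 h2
    simp only [Fin.val_zero, zero_mul, zero_add, Fin.val_succ, add_mul, one_mul,
      Finset.sum_add_distrib] at h2
    rcases Nat.eq_zero_or_pos (d 0) with h0 | h0
    · right
      refine ⟨Fin.tail d, ⟨⟨?_, ?_⟩, ?_⟩, ?_⟩
      · simp only [Fin.tail]; omega
      · simp only [Fin.tail]; omega
      · omega
      · funext i
        refine Fin.cases ?_ ?_ i
        · simp [shf, h0]
        · intro j; simp [shf, Fin.tail]
    · left
      refine ⟨Fin.cons (d 0 - 1) (Fin.tail d), ⟨?_, ?_⟩, ?_⟩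
      · rw [Fin.sum_univ_succ]; simp only [Fin.cons_zero, Fin.cons_succ, Fin.tail]; omega
      · rw [Fin.sum_univ_succ]; simp only [Fin.cons_zero, Fin.cons_succ, Fin.tail, Fin.val_zero,
          zero_mul, zero_add, Fin.val_succ, add_mul, one_mul, Finset.sum_add_distrib]; omega
      · funext i
        refine Fin.cases ?_ ?_ i
        · simp [upf]; omega
        · intro j; simp [upf, Fin.tail]
  · rintro (⟨e, ⟨h1, h2⟩, rfl⟩ | ⟨e, ⟨⟨h1, h2⟩, h3⟩, rfl⟩)
    · rw [Fin.sum_univ_succ] at h1 h2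
      simp only [Fin.val_zero, zero_mul, zero_add, Fin.val_succ] at h2
      constructor
      · rw [Fin.sum_univ_succ]; simp only [upf, Fin.cons_zero, Fin.cons_succ, Fin.tail]; omega
      · rw [Fin.sum_univ_succ]; simp only [upf, Fin.cons_zero, Fin.cons_succ, Fin.tail,
          Fin.val_zero, zero_mul, zero_add, Fin.val_succ]; omega
    · constructor
      · rw [Fin.sum_univ_succ]; simp only [shf, Fin.cons_zero, Fin.cons_succ]; omega
      · rw [Fin.sum_univ_succ]; simp only [shf, Fin.cons_zero, Fin.cons_succ,
          Fin.val_zero, zero_mul, zero_add, Fin.val_succ, add_mul, one_mul,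
          Finset.sum_add_distrib]; omega

lemma cs_card_rec (s k w : ℕ) : (cs (s+1) (k+1) w).ncard =
    (cs (s+1) k w).ncard + if k + 1 ≤ w then (cs s (k+1) (w - (k+1))).ncard else 0 := by
  rw [cs_rec, Set.ncard_union_eq ?_ ((cs_fin _ _ _).image _)
    (((cs_fin _ _ _).subset (fun d hd => hd.1)).image _), Set.ncard_image_of_injective _ upf_inj,
    Set.ncard_image_of_injective _ shf_inj]
  · split_ifs with h <;> simp [h]
  · rw [Set.disjoint_left]
    rintro _ ⟨d, -, rfl⟩ ⟨e, -, h⟩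
    have := congrFun h 0
    simp [upf, shf] at this

lemma cs_zero_right (s w : ℕ) : (cs s 0 w).ncard = if w = 0 then 1 else 0 := by
  split_ifs with h
  · subst h
    rw [Set.ncard_eq_one]
    refine ⟨0, ?_⟩
    ext d
    simp only [cs, Set.mem_ofPred_eq, Set.mem_singleton_iff]
    constructor
    · rintro ⟨h, -⟩
      funext i
      exact (Finset.sum_eq_zero_iff.1 h) i (Finset.mem_univ i)
    · rintro rfl; simp
  · have : cs s 0 w = ∅ := by
      ext d
      simp only [cs, Set.mem_ofPred_eq, Set.mem_empty_iff_false, iff_false]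
      rintro ⟨h1, h2⟩
      have : ∀ i, d i = 0 := fun i => (Finset.sum_eq_zero_iff.1 h1) i (Finset.mem_univ i)
      simp [this] at h2
      omega
    simp [this]

lemma cs_zero_left (k w : ℕ) : (cs 0 (k+1) w).ncard = 0 := by
  have : cs 0 (k+1) w = ∅ := by
    ext d
    simp [cs]
  simp [this]

lemma gauss_coeff : ∀ (s k w : ℕ), (gauss (s + k - 1) k).coeff w = ((cs s k w).ncard : ℤ)
  | s, 0, w => by
    rw [gauss_zero_right, cs_zero_right, coeff_one]; simp
  | 0, k+1, w => by
    rw [gauss_lt _ _ (by omega), cs_zero_left]; simp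
  | s+1, k+1, w => by
    have h1 := gauss_coeff (s+1) k w
    have h2 := gauss_coeff s (k+1) (w - (k+1))
    rw [show s + 1 + k - 1 = s + k by omega] at h1
    rw [show s + (k + 1) - 1 = s + k by omega] at h2
    rw [show s + 1 + (k+1) - 1 = s + k + 1 by omega, gauss_succ, cs_card_rec, coeff_add,
      coeff_X_pow_mul', h1]
    split_ifs with h
    · rw [h2]; push_cast; rfl
    · simp

/-- reversal -/
lemma cs_rev (a k w : ℕ) (h : w ≤ a * k) : (cs (a+1) k w).ncard = (cs (a+1) k (a*k - w)).ncard := by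
  have key : ∀ d : Fin (a+1) → ℕ, ∑ i, d i = k →
      ∑ i : Fin (a+1), (i:ℕ) * d (Fin.rev i) + ∑ i : Fin (a+1), (i:ℕ) * d i = a * k := by
    intro d hd
    rw [← Equiv.sum_comp Fin.revPerm]
    simp only [Fin.revPerm_apply, Fin.rev_rev]
    rw [← Finset.sum_add_distrib, ← hd, Finset.mul_sum]
    refine Finset.sum_congr rfl fun i _ => ?_
    rw [← add_mul, Fin.val_rev]
    congr 1
    have := i.2
    omega
  have hs : ∀ d : Fin (a+1) → ℕ, ∑ i, d (Fin.rev i) = ∑ i, d i := fun d =>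
    Equiv.sum_comp Fin.revPerm d
  have hinj : Function.Injective (fun d : Fin (a+1) → ℕ => fun i => d (Fin.rev i)) := by
    intro d e h
    funext i
    simpa using congrFun h (Fin.rev i)
  rw [← Set.ncard_image_of_injective _ hinj]
  congr 1
  ext d
  constructor
  · rintro ⟨e, ⟨h1, h2⟩, rfl⟩
    have := key e h1
    exact ⟨by rw [hs, h1], by simp only; omega⟩
  · rintro ⟨h1, h2⟩
    have := key d h1
    exact ⟨fun i => d (Fin.rev i), ⟨by rw [hs, h1], by simp only; omega⟩, by simp⟩

lemma cs_large (a k w : ℕ) (h : a * k < w) : (cs (a+1) k w).ncard = 0 := by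
  have : cs (a+1) k w = ∅ := by
    ext d
    simp only [cs, Set.mem_ofPred_eq, Set.mem_empty_iff_false, iff_false]
    rintro ⟨h1, h2⟩
    have : ∑ i : Fin (a+1), (i:ℕ) * d i ≤ ∑ i, a * d i :=
      Finset.sum_le_sum fun i _ => Nat.mul_le_mul_right _ (by omega)
    rw [← Finset.mul_sum, h1] at this
    omega
  simp [this]

lemma cs_zero_wt (a k : ℕ) : (cs (a+1) k 0).ncard = 1 := by
  induction k with
  | zero => simp [cs_zero_right]
  | succ k ih => rw [cs_card_rec, ih]; simp

namespace SL
open MvPolynomial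

abbrev P (a : ℕ) := MvPolynomial (Fin (a+1)) ℚ

noncomputable def y (a i : ℕ) : P a := if h : i < a + 1 then X ⟨i, h⟩ else 0

noncomputable def E (a : ℕ) : Derivation ℚ (P a) (P a) :=
  mkDerivation ℚ fun i => ((a:ℚ) - (i:ℕ)) • y a (i+1)
noncomputable def Fo (a : ℕ) : Derivation ℚ (P a) (P a) :=
  mkDerivation ℚ fun i => ((i:ℕ):ℚ) • y a (i-1)
noncomputable def H (a : ℕ) : Derivation ℚ (P a) (P a) :=
  mkDerivation ℚ fun i => (2 * ((i:ℕ):ℚ) - a) • X i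
noncomputable def N (a : ℕ) : Derivation ℚ (P a) (P a) :=
  mkDerivation ℚ fun i => X i

lemma X_eq (a : ℕ) (i : Fin (a+1)) : (X i : P a) = y a i := by
  rw [y, dif_pos i.2]

lemma y_big (a i : ℕ) (h : a < i) : y a i = 0 := by
  simp [y]; omega

lemma E_y (a i : ℕ) : E a (y a i) = ((a:ℚ) - i) • y a (i+1) := by
  by_cases h : i < a + 1
  · rw [← X_eq a ⟨i, h⟩, E, MvPolynomial.mkDerivation_X]
  · rw [y_big a i (by omega), y_big a (i+1) (by omega)]; simp

lemma F_y (a i : ℕ) (h : i ≤ a) : Fo a (y a i) = (i:ℚ) • y a (i-1) := by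
  rw [← X_eq a ⟨i, by omega⟩, Fo, MvPolynomial.mkDerivation_X]

lemma H_y (a i : ℕ) : H a (y a i) = (2 * (i:ℚ) - a) • y a i := by
  by_cases h : i < a + 1
  · rw [← X_eq a ⟨i, h⟩, H, MvPolynomial.mkDerivation_X]
  · rw [y_big a i (by omega)]; simp

lemma N_y (a i : ℕ) : N a (y a i) = y a i := by
  by_cases h : i < a + 1
  · rw [← X_eq a ⟨i, h⟩, N, MvPolynomial.mkDerivation_X]
  · rw [y_big a i (by omega)]; simp

lemma brEF (a : ℕ) : ⁅E a, Fo a⁆ = H a := by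
  refine derivation_ext fun i => ?_
  have hi : (i:ℕ) ≤ a := by omega
  rw [Derivation.commutator_apply, X_eq, F_y a i hi, E_y, H_y, Derivation.map_smul, Derivation.map_smul, E_y]
  have h1 : ((a:ℚ) - (i:ℕ)) • Fo a (y a (i+1)) = (((a:ℚ) - (i:ℕ)) * ((i:ℕ)+1)) • y a i := by
    rcases Nat.lt_or_ge (i:ℕ) a with h | h
    · rw [F_y a _ (by omega), smul_smul]; simp
    · have : (i:ℕ) = a := by omega
      rw [this]; simp
  have h2 : ((i:ℕ):ℚ) • (((a:ℚ) - ((i - 1 : ℕ):ℚ)) • y a (i - 1 + 1)) =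
      (((i:ℕ):ℚ) * (a - (i:ℕ) + 1)) • y a i := by
    rcases Nat.eq_zero_or_pos (i:ℕ) with h | h
    · rw [h]; simp
    · rw [Nat.sub_add_cancel h, smul_smul, Nat.cast_sub h]; congr 1; push_cast; ring
  rw [h1, h2, ← sub_smul]
  congr 1
  ring

lemma brHE (a : ℕ) : ⁅H a, E a⁆ = (2:ℚ) • E a := by
  refine derivation_ext fun i => ?_
  rw [Derivation.commutator_apply, X_eq, Derivation.smul_apply, E_y, H_y, Derivation.map_smul, Derivation.map_smul, E_y,
    H_y, smul_smul, smul_smul, ← sub_smul, smul_smul]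
  congr 1; push_cast; ring

lemma brHF (a : ℕ) : ⁅H a, Fo a⁆ = (-2:ℚ) • Fo a := by
  refine derivation_ext fun i => ?_
  have hi : (i:ℕ) ≤ a := by omega
  rw [Derivation.commutator_apply, X_eq, Derivation.smul_apply, F_y _ _ hi, H_y, Derivation.map_smul, Derivation.map_smul,
    F_y _ _ hi, H_y, smul_smul, smul_smul, ← sub_smul, smul_smul]
  rcases Nat.eq_zero_or_pos (i:ℕ) with h | h
  · rw [h]; simp
  · rw [Nat.cast_sub h]; congr 1; push_cast; ring

lemma brNE (a : ℕ) : ⁅N a, E a⁆ = 0 := by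
  refine derivation_ext fun i => ?_
  rw [Derivation.commutator_apply, X_eq, E_y, N_y, Derivation.map_smul, E_y, N_y]; simp

lemma brNF (a : ℕ) : ⁅N a, Fo a⁆ = 0 := by
  refine derivation_ext fun i => ?_
  have hi : (i:ℕ) ≤ a := by omega
  rw [Derivation.commutator_apply, X_eq, F_y _ _ hi, N_y, Derivation.map_smul, F_y _ _ hi, N_y]; simp

lemma EF (a : ℕ) (v : P a) : E a (Fo a v) = Fo a (E a v) + H a v := by
  rw [← brEF, Derivation.commutator_apply]; ring
lemma HE (a : ℕ) (v : P a) : H a (E a v) = E a (H a v) + (2:ℚ) • E a v := by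
  rw [← Derivation.smul_apply, ← brHE, Derivation.commutator_apply]; ring
lemma HF (a : ℕ) (v : P a) : H a (Fo a v) = Fo a (H a v) + (-2:ℚ) • Fo a v := by
  rw [← Derivation.smul_apply, ← brHF, Derivation.commutator_apply]; ring
lemma NE (a : ℕ) (v : P a) : N a (E a v) = E a (N a v) := by
  have := congrArg (fun D => D v) (brNE a)
  simp only [Derivation.commutator_apply, Derivation.zero_apply] at this
  exact sub_eq_zero.1 this
lemma NF (a : ℕ) (v : P a) : N a (Fo a v) = Fo a (N a v) := by
  have := congrArg (fun D => D v) (brNF a)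
  simp only [Derivation.commutator_apply, Derivation.zero_apply] at this
  exact sub_eq_zero.1 this

noncomputable def Q (a : ℕ) : P a :=
  ∑ i ∈ Finset.range (a+1), ((-1:ℚ)^i * (a.choose i : ℚ)) • (y a i * y a (a - i))

lemma choose_aux (a i : ℕ) (h : i ≤ a) :
    (a.choose i : ℚ) * (a - i) = (a.choose (i+1) : ℚ) * (i + 1) := by
  have := Nat.choose_succ_right_eq a i
  rw [← Nat.cast_sub h]
  exact_mod_cast this.symm

lemma E_Q (a : ℕ) : E a (Q a) = 0 := by
  let T : ℕ → P a := fun j => ((-1:ℚ)^j * (a.choose j : ℚ) * j) • (y a j * y a (a + 1 - j))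
  have : E a (Q a) = ∑ i ∈ Finset.range (a+1), (T i - T (i+1)) := by
    rw [Q, map_sum]
    refine Finset.sum_congr rfl fun i hi => ?_
    have hi : i ≤ a := by simp at hi; omega
    have hc := choose_aux a i hi
    rw [Derivation.map_smul, Derivation.leibniz, E_y, E_y]
    simp only [T]
    rw [show a - i + 1 = a + 1 - i by omega, show a + 1 - (i+1) = a - i by omega,
      Nat.cast_sub hi, Nat.cast_add_one]
    have e : (-1:ℚ)^(i+1) * (a.choose (i+1) : ℚ) * (i+1) = - ((-1:ℚ)^i * ((a.choose i : ℚ) * (a - i))) := by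
      rw [hc]; ring
    rw [e]
    simp only [smul_eq_mul, MvPolynomial.smul_eq_C_mul, map_mul, map_sub, map_neg, map_pow, map_one]
    ring
  rw [this, Finset.sum_range_sub']
  simp [T]

lemma F_Q (a : ℕ) : Fo a (Q a) = 0 := by
  let T : ℕ → P a := fun j => ((-1:ℚ)^j * (a.choose j : ℚ) * j) • (y a (j-1) * y a (a - j))
  have : Fo a (Q a) = ∑ i ∈ Finset.range (a+1), (T i - T (i+1)) := by
    rw [Q, map_sum]
    refine Finset.sum_congr rfl fun i hi => ?_
    have hi : i ≤ a := by simp at hi; omega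
    have hc := choose_aux a i hi
    rw [Derivation.map_smul, Derivation.leibniz, F_y a i hi, F_y a (a-i) (by omega)]
    simp only [T]
    rw [show i + 1 - 1 = i by omega, show a - (i+1) = a - i - 1 by omega,
      Nat.cast_sub hi, Nat.cast_add_one]
    have e : (-1:ℚ)^(i+1) * (a.choose (i+1) : ℚ) * (i+1) = - ((-1:ℚ)^i * ((a.choose i : ℚ) * (a - i))) := by
      rw [hc]; ring
    rw [e]
    simp only [smul_eq_mul, MvPolynomial.smul_eq_C_mul, map_mul, map_sub, map_neg, map_pow, map_one]
    ring
  rw [this, Finset.sum_range_sub']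
  simp [T]

lemma H_Q (a : ℕ) : H a (Q a) = 0 := by
  rw [Q, map_sum]
  refine Finset.sum_eq_zero fun i hi => ?_
  have hi : i ≤ a := by simp at hi; omega
  rw [Derivation.map_smul, Derivation.leibniz, H_y, H_y, Nat.cast_sub hi]
  simp only [smul_eq_mul, MvPolynomial.smul_eq_C_mul, map_mul, map_sub, map_pow, map_one, map_ofNat]
  ring

lemma N_Q (a : ℕ) : N a (Q a) = (2:ℚ) • Q a := by
  rw [Q, map_sum, Finset.smul_sum]
  refine Finset.sum_congr rfl fun i hi => ?_
  rw [Derivation.map_smul, Derivation.leibniz, N_y, N_y, smul_comm, two_smul]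
  simp only [smul_eq_mul]
  rw [mul_comm (y a (a-i))]

lemma Q_ne (b : ℕ) : Q (2*b) ≠ 0 := by
  intro h
  let f : Fin (2*b+1) → ℚ := fun i => if (i:ℕ) = b then 1 else 0
  have hy : ∀ i, MvPolynomial.aeval f (y (2*b) i) = if i = b then (1:ℚ) else 0 := by
    intro i
    by_cases hi : i < 2*b+1
    · rw [← X_eq _ ⟨i, hi⟩, MvPolynomial.aeval_X]
    · rw [y_big _ _ (by omega), if_neg (by omega), map_zero]
  have h2 := congrArg (MvPolynomial.aeval f) h
  rw [Q, map_sum, map_zero, Finset.sum_eq_single b] at h2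
  · rw [map_smul, map_mul, hy, hy, if_pos rfl, if_pos (by omega)] at h2
    simp only [smul_eq_mul, mul_one, mul_eq_zero] at h2
    rcases h2 with h2 | h2
    · exact absurd h2 (pow_ne_zero _ (by norm_num))
    · have : (2*b).choose b ≠ 0 := (Nat.choose_pos (by omega)).ne'
      exact this (by exact_mod_cast h2)
  · intro i _ hi
    rw [map_smul, map_mul, hy, if_neg hi]; simp
  · intro hb; simp at hb; omega

/-- weight spaces -/
noncomputable def V (a : ℕ) (k w : ℚ) : Submodule ℚ (P a) where
  carrier := {v | N a v = k • v ∧ H a v = w • v}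
  add_mem' := by
    rintro u v ⟨h1, h2⟩ ⟨h3, h4⟩
    exact ⟨by rw [map_add, h1, h3, smul_add], by rw [map_add, h2, h4, smul_add]⟩
  zero_mem' := by simp
  smul_mem' := by
    rintro c v ⟨h1, h2⟩
    exact ⟨by rw [Derivation.map_smul, h1, smul_comm], by rw [Derivation.map_smul, h2, smul_comm]⟩

lemma mem_V {a : ℕ} {k w : ℚ} {v : P a} : v ∈ V a k w ↔ N a v = k • v ∧ H a v = w • v := Iff.rfl

lemma E_V {a : ℕ} {k w : ℚ} {v : P a} (h : v ∈ V a k w) : E a v ∈ V a k (w+2) := by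
  obtain ⟨h1, h2⟩ := h
  exact ⟨by rw [NE, h1, Derivation.map_smul], by rw [HE, h2, Derivation.map_smul, add_smul]⟩

lemma F_V {a : ℕ} {k w : ℚ} {v : P a} (h : v ∈ V a k w) : Fo a v ∈ V a k (w-2) := by
  obtain ⟨h1, h2⟩ := h
  exact ⟨by rw [NF, h1, Derivation.map_smul], by rw [HF, h2, Derivation.map_smul, sub_smul, neg_smul, sub_eq_add_neg]⟩

lemma Q_V {a : ℕ} {k w : ℚ} {v : P a} (h : v ∈ V a k w) : Q a * v ∈ V a (k+2) w := by
  obtain ⟨h1, h2⟩ := h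
  refine ⟨?_, ?_⟩
  · rw [Derivation.leibniz, N_Q, h1, add_smul]
    simp only [smul_eq_mul, MvPolynomial.smul_eq_C_mul]; ring
  · rw [Derivation.leibniz, H_Q, h2]
    simp only [smul_eq_mul, MvPolynomial.smul_eq_C_mul]; ring

lemma E_Qmul (a : ℕ) (v : P a) : E a (Q a * v) = Q a * E a v := by
  rw [Derivation.leibniz, E_Q]; simp
lemma F_Qmul (a : ℕ) (v : P a) : Fo a (Q a * v) = Q a * Fo a v := by
  rw [Derivation.leibniz, F_Q]; simp

lemma Fpow_V {a : ℕ} {k w : ℚ} {v : P a} (h : v ∈ V a k w) (j : ℕ) :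
    (Fo a)^[j] v ∈ V a k (w - 2*j) := by
  induction j with
  | zero => simpa using h
  | succ j ih =>
    rw [Function.iterate_succ_apply']
    have := F_V ih
    rwa [show w - 2 * (j:ℚ) - 2 = w - 2 * ((j+1:ℕ):ℚ) by push_cast; ring] at this

lemma FEF {a : ℕ} {k w : ℚ} {v u0 : P a} (h : v ∈ V a k w) (hu0 : u0 ∈ V a (k-2) (w+2))
    (he : E a v = Q a * u0) (j : ℕ) : ∃ u ∈ V a (k-2) (w - 2*j),
      Fo a (E a ((Fo a)^[j] v)) = ((j:ℚ) * (w - j + 1)) • (Fo a)^[j] v + Q a * u := by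
  induction j with
  | zero =>
    refine ⟨Fo a u0, ?_, ?_⟩
    · have := F_V hu0
      rwa [show w + 2 - 2 = w - 2 * ((0:ℕ):ℚ) by push_cast; ring] at this
    · rw [Function.iterate_zero_apply, he, F_Qmul]; simp
  | succ j ih =>
    obtain ⟨u, hu, e⟩ := ih
    refine ⟨Fo a u, ?_, ?_⟩
    · have := F_V hu
      rwa [show w - 2 * (j:ℚ) - 2 = w - 2 * ((j+1:ℕ):ℚ) by push_cast; ring] at this
    · rw [Function.iterate_succ_apply', EF, e, (Fpow_V h j).2, map_add, map_add, F_Qmul, Derivation.map_smul,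
        Derivation.map_smul, add_right_comm, ← add_smul]
      congr 2
      push_cast; ring

lemma descend {a : ℕ} {k w : ℚ} {v u0 : P a} (hw : w < 0) (h : v ∈ V a k w)
    (hu0 : u0 ∈ V a (k-2) (w+2))
    (he : E a v = Q a * u0) (j : ℕ) (hj : ∃ u ∈ V a (k-2) (w - 2*j), (Fo a)^[j] v = Q a * u) :
    ∃ u ∈ V a (k-2) w, v = Q a * u := by
  induction j with
  | zero => simpa using hj
  | succ j ih =>
    apply ih
    obtain ⟨u, hu, e⟩ := hj
    obtain ⟨u', hu', e'⟩ := FEF h hu0 he j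
    have h1 := EF a ((Fo a)^[j] v)
    rw [← Function.iterate_succ_apply' (Fo a), e, E_Qmul, e', (Fpow_V h j).2] at h1
    set c : ℚ := (j:ℚ) * (w - j + 1) + (w - 2*j) with hc
    have hc0 : c ≠ 0 := by
      have : c = (j+1) * (w - j) := by rw [hc]; ring
      rw [this]
      have : (0:ℚ) ≤ j := by positivity
      exact mul_ne_zero (by linarith) (by linarith)
    have h2 : c • (Fo a)^[j] v = Q a * (E a u - u') := by
      rw [hc, add_smul, mul_sub, h1]; ring
    refine ⟨c⁻¹ • (E a u - u'), ?_, ?_⟩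
    · refine Submodule.smul_mem _ _ (Submodule.sub_mem _ ?_ hu')
      have := E_V hu
      rwa [show w - 2 * ((j+1:ℕ):ℚ) + 2 = w - 2*j by push_cast; ring] at this
    · rw [mul_smul_comm, ← h2, smul_smul, inv_mul_cancel₀ hc0, one_smul]

/-- the diagonal derivation on coefficients -/
lemma coeff_diag {a : ℕ} (c : Fin (a+1) → ℚ) (v : P a) (d : Fin (a+1) →₀ ℕ) :
    coeff d (mkDerivation ℚ (fun i => c i • (X i : P a)) v) = (∑ i, c i * d i) * coeff d v := by
  induction v using MvPolynomial.induction_on' with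
  | monomial e r =>
    have : mkDerivation ℚ (fun i => c i • (X i : P a)) (monomial e r) =
        (∑ i, c i * e i) • monomial e r := by
      rw [mkDerivation_monomial, Finsupp.sum_fintype _ _ (by simp), Finset.sum_smul, Finset.smul_sum]
      refine Finset.sum_congr rfl fun i _ => ?_
      rcases Nat.eq_zero_or_pos (e i) with h0 | h0
      · simp [h0]
      · rw [smul_eq_mul, mul_smul_comm, MvPolynomial.X, monomial_mul, MvPolynomial.smul_monomial, MvPolynomial.smul_monomial, MvPolynomial.smul_monomial,
          tsub_add_cancel_of_le (Finsupp.single_le_iff.2 h0)]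
        congr 1
        simp only [smul_eq_mul]; ring
    rw [this, MvPolynomial.coeff_smul, MvPolynomial.coeff_monomial]
    split_ifs with h
    · rw [h, smul_eq_mul]
    · simp
  | add p q hp hq => rw [map_add, MvPolynomial.coeff_add, hp, hq, MvPolynomial.coeff_add]; ring

lemma mem_V_iff {a : ℕ} {k w : ℚ} {v : P a} : v ∈ V a k w ↔
    ∀ d, coeff d v ≠ 0 → (∑ i, (d i : ℚ)) = k ∧ ∑ i : Fin (a+1), (2 * ((i:ℕ):ℚ) - a) * d i = w := by
  have hN : ∀ d, coeff d (N a v) = (∑ i, (d i : ℚ)) * coeff d v := by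
    intro d
    have := coeff_diag (a := a) (fun _ => 1) v d
    simpa [N] using this
  have hH : ∀ d, coeff d (H a v) = (∑ i : Fin (a+1), (2 * ((i:ℕ):ℚ) - a) * d i) * coeff d v :=
    fun d => coeff_diag _ v d
  constructor
  · rintro ⟨h1, h2⟩ d hd
    have e1 := hN d
    have e2 := hH d
    rw [h1, MvPolynomial.coeff_smul, smul_eq_mul] at e1
    rw [h2, MvPolynomial.coeff_smul, smul_eq_mul] at e2
    exact ⟨(mul_right_cancel₀ hd e1).symm, (mul_right_cancel₀ hd e2).symm⟩
  · intro h
    refine ⟨?_, ?_⟩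
    · ext d
      rw [hN, MvPolynomial.coeff_smul, smul_eq_mul]
      by_cases hd : coeff d v = 0
      · simp [hd]
      · rw [(h d hd).1]
    · ext d
      rw [hH, MvPolynomial.coeff_smul, smul_eq_mul]
      by_cases hd : coeff d v = 0
      · simp [hd]
      · rw [(h d hd).2]

def ws (a : ℕ) (k w : ℚ) : Set (Fin (a+1) →₀ ℕ) :=
  {d | (∑ i, (d i : ℚ)) = k ∧ ∑ i : Fin (a+1), (2 * ((i:ℕ):ℚ) - a) * d i = w}

lemma V_eq (a : ℕ) (k w : ℚ) : V a k w = restrictSupport ℚ (ws a k w) := by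
  ext v
  rw [mem_V_iff, mem_restrictSupport_iff]
  constructor
  · intro h d hd
    exact h d (by simpa using hd)
  · intro h d hd
    exact h (by simpa using hd)

lemma ws_fin (a : ℕ) (k w : ℚ) : (ws a k w).Finite := by
  obtain ⟨n, hn⟩ := exists_nat_ge k
  have : ((fun f : Fin (a+1) →₀ ℕ => (f : Fin (a+1) → ℕ)) ⁻¹' (Set.Iic (fun _ => n))).Finite :=
    (Set.finite_Iic (fun _ : Fin (a+1) => n)).preimage (DFunLike.coe_injective.injOn)
  refine this.subset ?_
  rintro d ⟨h, -⟩ i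
  have h2 : (d i : ℚ) ≤ ∑ i, (d i : ℚ) :=
    Finset.single_le_sum (f := fun i => (d i : ℚ)) (fun _ _ => by positivity) (Finset.mem_univ i)
  have : (d i : ℚ) ≤ n := by linarith
  exact_mod_cast this

instance (a : ℕ) (k w : ℚ) : Module.Finite ℚ (V a k w) := by
  rw [V_eq]
  have := (ws_fin a k w).to_subtype
  exact Module.Finite.of_basis (basisRestrictSupport ℚ (ws a k w))

lemma finrank_V (a : ℕ) (k w : ℚ) : Module.finrank ℚ (V a k w) = (ws a k w).ncard := by
  rw [V_eq, Module.finrank_eq_nat_card_basis (basisRestrictSupport ℚ (ws a k w))]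
  rfl

lemma F_nil {a : ℕ} {k w : ℚ} {v : P a} (h : v ∈ V a k w) : ∃ j : ℕ, (Fo a)^[j] v = 0 := by
  obtain ⟨j, hj⟩ := exists_nat_gt (w + a * k)
  refine ⟨j, ?_⟩
  by_contra h0
  obtain ⟨d, hd⟩ := MvPolynomial.ne_zero_iff.1 h0
  obtain ⟨h1, h2⟩ := mem_V_iff.1 (Fpow_V h j) d hd
  have : ∑ i : Fin (a+1), (-(a:ℚ)) * d i ≤ ∑ i : Fin (a+1), (2 * ((i:ℕ):ℚ) - a) * d i := by
    refine Finset.sum_le_sum fun i _ => mul_le_mul_of_nonneg_right ?_ (by positivity)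
    have : (0:ℚ) ≤ ((i:ℕ):ℚ) := by positivity
    linarith
  rw [← Finset.mul_sum, h1, h2] at this
  have : (0:ℚ) ≤ j := by positivity
  linarith

lemma key {a : ℕ} {k w : ℚ} {v u0 : P a} (hw : w < 0) (h : v ∈ V a k w)
    (hu0 : u0 ∈ V a (k-2) (w+2)) (he : E a v = Q a * u0) :
    ∃ u ∈ V a (k-2) w, v = Q a * u := by
  obtain ⟨j, hj⟩ := F_nil h
  exact descend hw h hu0 he j ⟨0, Submodule.zero_mem _, by simp [hj]⟩

lemma dim_ineq (b : ℕ) (k w : ℚ) (hw : w < 0) :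
    Module.finrank ℚ (V (2*b) k w) + Module.finrank ℚ (V (2*b) (k-2) (w+2)) ≤
    Module.finrank ℚ (V (2*b) k (w+2)) + Module.finrank ℚ (V (2*b) (k-2) w) := by
  set a := 2*b with ha
  have hQ : Q a ≠ 0 := Q_ne b
  let ψ0 : (V a k w × V a (k-2) (w+2)) →ₗ[ℚ] P a :=
    ((E a : P a →ₗ[ℚ] P a) ∘ₗ (V a k w).subtype).coprod
      (-(LinearMap.mulLeft ℚ (Q a) ∘ₗ (V a (k-2) (w+2)).subtype))
  have hψ0 : ∀ p, ψ0 p = E a p.1 - Q a * p.2 := by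
    intro p; simp [ψ0, sub_eq_add_neg]
  let χ : V a (k-2) w →ₗ[ℚ] (V a k w × V a (k-2) (w+2)) :=
    LinearMap.prod
      ((LinearMap.mulLeft ℚ (Q a) ∘ₗ (V a (k-2) w).subtype).codRestrict _ (fun u => by
        have := Q_V u.2
        rwa [sub_add_cancel] at this))
      (((E a : P a →ₗ[ℚ] P a) ∘ₗ (V a (k-2) w).subtype).codRestrict _ (fun u => E_V u.2))
  have h1 := LinearMap.finrank_range_add_finrank_ker ψ0
  have h2 : Module.finrank ℚ (LinearMap.range ψ0) ≤ Module.finrank ℚ (V a k (w+2)) := by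
    refine Submodule.finrank_mono ?_
    rintro _ ⟨p, rfl⟩
    rw [hψ0]
    refine Submodule.sub_mem _ (E_V p.1.2) ?_
    have := Q_V p.2.2
    rwa [sub_add_cancel] at this
  have h3 : Module.finrank ℚ (LinearMap.ker ψ0) ≤ Module.finrank ℚ (LinearMap.range χ) := by
    refine Submodule.finrank_mono ?_
    intro p hp
    rw [LinearMap.mem_ker, hψ0, sub_eq_zero] at hp
    obtain ⟨u, hu, e⟩ := key hw p.1.2 p.2.2 hp
    refine ⟨⟨u, hu⟩, ?_⟩
    refine Prod.ext (Subtype.ext ?_) (Subtype.ext ?_)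
    · exact e.symm
    · rw [e, E_Qmul] at hp
      exact mul_left_cancel₀ hQ hp
  have h4 := LinearMap.finrank_range_le χ
  rw [Module.finrank_prod] at h1
  omega

end SL

namespace SL

lemma wt_sum (a : ℕ) (d : Fin (a+1) →₀ ℕ) :
    ∑ i : Fin (a+1), (2 * ((i:ℕ):ℚ) - a) * d i =
      2 * ((∑ i : Fin (a+1), (i:ℕ) * d i : ℕ) : ℚ) - a * ((∑ i, d i : ℕ) : ℚ) := by
  push_cast
  rw [Finset.mul_sum, Finset.mul_sum, ← Finset.sum_sub_distrib]
  refine Finset.sum_congr rfl fun i _ => by ring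

lemma ws_preimage (a k t : ℕ) : (ws a (k:ℚ) (2 * (t:ℚ) - a * k)) =
    (Finsupp.equivFunOnFinite : (Fin (a+1) →₀ ℕ) ≃ (Fin (a+1) → ℕ)) ⁻¹' cs (a+1) k t := by
  ext d
  change ((∑ i, (d i : ℚ)) = k ∧ _ = _) ↔ ((∑ i, d i) = k ∧ (∑ i : Fin (a+1), (i:ℕ) * d i) = t)
  rw [wt_sum, ← Nat.cast_sum, Nat.cast_inj]
  refine and_congr_right fun h => ?_
  rw [h]
  constructor
  · intro h2
    have : ((∑ i : Fin (a+1), (i:ℕ) * d i : ℕ) : ℚ) = t := by linarith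
    exact_mod_cast this
  · intro h2; rw [h2]

lemma ws_card (a k t : ℕ) : (ws a (k:ℚ) (2 * (t:ℚ) - a * k)).ncard = (cs (a+1) k t).ncard := by
  rw [ws_preimage, Set.ncard_preimage_of_injective_subset_range (Equiv.injective _)]
  simp

lemma ws_card2 (a k t : ℕ) : (ws a (k:ℚ) (2 * (t:ℚ) - a * (k+2))).ncard =
    if a ≤ t then (cs (a+1) k (t-a)).ncard else 0 := by
  split_ifs with h
  · rw [← ws_card, Nat.cast_sub h]
    congr 2; ring
  · have : ws a (k:ℚ) (2 * (t:ℚ) - a * (k+2)) = ∅ := by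
      ext d
      simp only [Set.mem_empty_iff_false, iff_false]
      rintro ⟨h1, h2⟩
      rw [wt_sum] at h2
      rw [← Nat.cast_sum] at h1
      rw [h1] at h2
      have h3 : ((∑ i : Fin (a+1), (i:ℕ) * d i : ℕ) : ℚ) + a = t := by linarith
      have h4 : (∑ i : Fin (a+1), (i:ℕ) * d i) + a = t := by exact_mod_cast h3
      omega
    rw [this]; simp

end SL

/-- The symmetric difference. -/
noncomputable def RS (a m : ℕ) : Polynomial ℤ :=
  gauss (a + (m+2)) (m+2) - X^a * gauss (a + m) m

lemma RS_coeff (a m t : ℕ) : (RS a m).coeff t =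
    ((cs (a+1) (m+2) t).ncard : ℤ) - ((if a ≤ t then (cs (a+1) m (t-a)).ncard else 0 : ℕ) : ℤ) := by
  have h1 := gauss_coeff (a+1) (m+2) t
  have h2 := gauss_coeff (a+1) m (t-a)
  rw [show a + 1 + (m+2) - 1 = a + (m+2) by omega] at h1
  rw [show a + 1 + m - 1 = a + m by omega] at h2
  rw [RS, coeff_sub, coeff_X_pow_mul', h1, h2]
  split_ifs <;> simp

lemma RS_mono (b m t : ℕ) (h : 2 * t < 2 * b * (m+2)) :
    (RS (2*b) m).coeff t ≤ (RS (2*b) m).coeff (t+1) := by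
  have hw : 2 * (t:ℚ) - ((2*b:ℕ):ℚ) * ((m:ℚ)+2) < 0 := by
    have : ((2 * t : ℕ):ℚ) < ((2 * b * (m+2) : ℕ) : ℚ) := by exact_mod_cast h
    push_cast at this ⊢
    linarith
  have key := SL.dim_ineq b ((m:ℚ)+2) _ hw
  have e : 2 * (t:ℚ) - ((2*b:ℕ):ℚ) * ((m:ℚ)+2) + 2 = 2 * ((t+1:ℕ):ℚ) - ((2*b:ℕ):ℚ) * ((m:ℚ)+2) := by
    push_cast; ring
  rw [e, add_sub_cancel_right] at key
  simp only [SL.finrank_V] at key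
  rw [SL.ws_card2, SL.ws_card2] at key
  have e2 : ((m:ℚ) + 2) = ((m+2:ℕ):ℚ) := by push_cast; ring
  rw [e2, SL.ws_card, SL.ws_card] at key
  rw [RS_coeff, RS_coeff]
  omega

lemma RS_symm (a m t : ℕ) (h : t ≤ a * (m+2)) :
    (RS a m).coeff t = (RS a m).coeff (a * (m+2) - t) := by
  rw [RS_coeff, RS_coeff, cs_rev a (m+2) t h]
  congr 2
  have e : a * (m+2) = a * m + 2 * a := by ring
  by_cases h1 : a ≤ t
  · rw [if_pos h1]
    by_cases h2 : a ≤ a * (m+2) - t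
    · rw [if_pos h2, cs_rev a m _ (by omega)]
      congr 2
      omega
    · rw [if_neg h2, cs_large _ _ _ (by omega)]
  · rw [if_neg h1]
    by_cases h2 : a ≤ a * (m+2) - t
    · rw [if_pos h2, cs_large _ _ _ (by omega)]
    · rw [if_neg h2]

lemma RS_deg (a m : ℕ) (ha : 0 < a) : (RS a m).natDegree = a * (m+2) := by
  refine natDegree_eq_of_le_of_coeff_ne_zero ?_ ?_
  · rw [natDegree_le_iff_coeff_eq_zero]
    intro t ht
    have e : a * (m+2) = a * m + 2 * a := by ring
    rw [RS_coeff, cs_large _ _ _ ht, if_pos (by omega), cs_large _ _ _ (by omega)]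
    simp
  · rw [RS_symm a m _ le_rfl, Nat.sub_self, RS_coeff, cs_zero_wt, if_neg (by omega)]
    simp

/-- For every even positive integer `n`, the polynomial
`((1-q^(3n+1))/(1-q))·C_n(q) = (1 + q + ⋯ + q^(3n))·C_n(q)` is symmetric and
unimodal, where the `q`-Catalan polynomial `C_n(q)` is characterized by
`(1-q^(n+1))·C_n(q) = (1-q)·[2n n]_q`. -/
theorem qCatalan_mul_symmetric_unimodal (n : ℕ) (hn : 1 ≤ n) (heven : Even n)
    (C : Polynomial ℤ)
    (hC : (1 - X ^ (n + 1)) * C = (1 - X) * gauss (2 * n) n)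
    (F : Polynomial ℤ) (hF : F = (∑ i ∈ Finset.range (3 * n + 1), X ^ i) * C) :
    (∀ i ≤ F.natDegree, F.coeff i = F.coeff (F.natDegree - i)) ∧
    (∀ i < F.natDegree / 2, F.coeff i ≤ F.coeff (i + 1)) ∧
    (∀ i, F.natDegree / 2 ≤ i → i < F.natDegree →
      F.coeff (i + 1) ≤ F.coeff i) := by
  obtain ⟨c, hc⟩ := heven
  obtain ⟨m, rfl⟩ : ∃ m, n = m + 2 := ⟨n - 2, by omega⟩
  obtain ⟨b, hb⟩ : ∃ b, m + 4 = 2 * b := ⟨c + 1, by omega⟩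
  have hFe : F = RS (2*b) m := by
    rw [F_eq m C hC F hF, RS, hb]
  have hd : F.natDegree = 2*b*(m+2) := by rw [hFe, RS_deg _ _ (by omega)]
  have e : 2 * b * (m+2) = 2 * (b * (m+2)) := by ring
  have hsym : ∀ i ≤ F.natDegree, F.coeff i = F.coeff (F.natDegree - i) := by
    intro i hi
    rw [hd] at hi ⊢
    rw [hFe]
    exact RS_symm _ _ _ hi
  have hmono : ∀ i < F.natDegree / 2, F.coeff i ≤ F.coeff (i + 1) := by
    intro i hi
    rw [hd] at hi
    rw [hFe]
    exact RS_mono _ _ _ (by omega)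
  refine ⟨hsym, hmono, ?_⟩
  intro i h1 h2
  rw [hsym i h2.le, hsym (i+1) h2]
  have := hmono (F.natDegree - (i+1)) (by omega)
  rwa [show F.natDegree - (i+1) + 1 = F.natDegree - i by omega] at this
end

section
/- For n ≥ 1 and 0 ≤ m ≤ n, the q-Kaplansky number K_q(n,m) is a polynomial in q with nonnegative integer coefficients, of degree m(n−m)+m, and it is symmetric: its coefficient of q^i equals its coefficient of q^{m(n−m)+m−i} for all 0 ≤ i ≤ m(n−m)+m. -/
open Polynomial Finset

lemma gauss_nonneg (n : ℕ) : ∀ m i, 0 ≤ (gauss n m).coeff i := by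
  induction n with
  | zero =>
    intro m i
    cases m with
    | zero => simp only [gauss, coeff_one]; split_ifs <;> simp
    | succ m => simp [gauss]
  | succ n ih =>
    intro m i
    cases m with
    | zero => simp only [gauss, coeff_one]; split_ifs <;> simp
    | succ m =>
      simp only [gauss, coeff_add, coeff_X_pow_mul']
      have h1 := ih m i
      split_ifs
      · have h2 := ih (m+1) (i - (m+1))
        omega
      · omega

lemma gauss_eq_zero (n : ℕ) : ∀ m, n < m → gauss n m = 0 := by
  induction n with
  | zero =>
    intro m hm
    cases m with
    | zero => omega
    | succ m => simp [gauss]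
  | succ n ih =>
    intro m hm
    cases m with
    | zero => omega
    | succ m => simp [gauss, ih m (by omega), ih (m+1) (by omega)]

lemma gauss_coeff_zero (n : ℕ) : ∀ m, m ≤ n → (gauss n m).coeff 0 = 1 := by
  induction n with
  | zero =>
    intro m hm
    obtain rfl : m = 0 := by omega
    simp [gauss]
  | succ n ih =>
    intro m hm
    cases m with
    | zero => simp [gauss]
    | succ m => simp [gauss, coeff_X_pow_mul', ih m (by omega)]

lemma gauss_pascal (n : ℕ) : ∀ m, m ≤ n →
    gauss (n+1) (m+1) = gauss n (m+1) + X ^ (n - m) * gauss n m := by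
  induction n with
  | zero =>
    intro m hm
    obtain rfl : m = 0 := by omega
    simp [gauss]
  | succ n ih =>
    intro m hm
    rcases Nat.lt_or_ge n m with h | h
    · obtain rfl : m = n + 1 := by omega
      rw [gauss, gauss_eq_zero (n+1) (n+1+1) (by omega)]
      simp
    · rw [gauss, ih m h]
      cases m with
      | zero =>
        simp only [gauss_zero_right]
        have h1 : gauss (n+1) 1 = gauss n 0 + X ^ 1 * gauss n 1 := gauss.eq_3 n 0
        have h2 := ih 0 (by omega)
        simp only [gauss_zero_right, zero_add, Nat.sub_zero] at h1 h2 ⊢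
        rw [pow_succ]
        linear_combination h2 - h1
      | succ m =>
        have h1 : gauss (n+1) (m+1+1) = gauss n (m+1) + X ^ (m+1+1) * gauss n (m+1+1) := by rw [gauss]
        have h2 := ih m (by omega)
        have h3 : gauss (n+1) (m+1) = gauss n m + X ^ (m+1) * gauss n (m+1) := by rw [gauss]
        have h4 := ih (m+1) h
        obtain ⟨a, rfl⟩ : ∃ a, n = m + 1 + a := ⟨n - (m+1), by omega⟩
        have e1 : m + 1 + a - m = a + 1 := by omega
        have e2 : m + 1 + a - (m + 1) = a := by omega
        have e3 : m + 1 + a + 1 - (m + 1) = a + 1 := by omega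
        rw [e1] at h2
        rw [e2] at h4
        rw [e2, e3]
        linear_combination h2 - h1 + h4 - X^(a+1) * h3

def Sy (d : ℕ) (p : Polynomial ℤ) : Prop := p.natDegree ≤ d ∧ reflect d p = p

lemma reflect_up (d k : ℕ) (p : Polynomial ℤ) (h : p.natDegree ≤ d) :
    reflect (k + d) p = X ^ k * reflect d p := by
  have := reflect_mul (1 : Polynomial ℤ) p (F := k) (G := d) (by simp) h
  rw [one_mul] at this
  rw [this, reflect_one]

lemma reflect_down (d k : ℕ) (p : Polynomial ℤ) (h : p.natDegree ≤ d) :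
    reflect (k + d) (X ^ k * p) = reflect d p := by
  rw [reflect_mul (X ^ k : Polynomial ℤ) p (F := k) (G := d) (by simp) h, reflect_monomial]
  simp

lemma natDegree_shift (d k : ℕ) (p : Polynomial ℤ) (h : p.natDegree ≤ d) :
    (X ^ k * p).natDegree ≤ k + d := by
  refine natDegree_mul_le.trans ?_
  simp
  omega

lemma gauss_sy (n : ℕ) : ∀ m, m ≤ n → Sy (m * (n - m)) (gauss n m) := by
  induction n with
  | zero =>
    intro m hm
    obtain rfl : m = 0 := by omega
    simp [Sy, gauss]
  | succ n ih =>
    intro m hm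
    cases m with
    | zero => simp [Sy, gauss]
    | succ m =>
      obtain ⟨a, rfl⟩ : ∃ a, n = m + a := ⟨n - m, by omega⟩
      have h1 := ih m (by omega)
      have hp := gauss_pascal (m+a) m (by omega)
      have e1 : m + a - m = a := by omega
      have e2 : m + a + 1 - (m + 1) = a := by omega
      rw [e1] at h1 hp
      rw [e2]
      have h2 : Sy ((m+1) * (a - 1)) (gauss (m+a) (m+1)) := by
        rcases Nat.eq_zero_or_pos a with rfl | ha
        · rw [gauss_eq_zero _ _ (by omega)]; simp [Sy]
        · have := ih (m+1) (by omega)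
          rwa [show m + a - (m+1) = a - 1 by omega] at this
      rcases Nat.eq_zero_or_pos a with rfl | ha
      · rw [gauss, gauss_eq_zero m (m+1) (by omega)]
        simpa using h1
      · obtain ⟨b, rfl⟩ : ∃ b, a = b + 1 := ⟨a - 1, by omega⟩
        simp only [Nat.add_sub_cancel] at h2
        have d1 : (m+1) * (b+1) = (b+1) + m * (b+1) := by ring
        have d2 : (m+1) * (b+1) = (m+1) + (m+1) * b := by ring
        constructor
        · rw [gauss]
          refine natDegree_add_le_of_degree_le ?_ ?_
          · rw [d1]; exact h1.1.trans (by omega)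
          · rw [d2]; exact natDegree_shift _ _ _ h2.1
        · conv_lhs => rw [gauss]
          rw [reflect_add]
          conv_lhs =>
            congr
            · rw [d1, reflect_up _ _ _ h1.1, h1.2]
            · rw [d2, reflect_down _ _ _ h2.1, h2.2]
          rw [hp, add_comm]

lemma kap_sy (n m : ℕ) (hmn : m ≤ n) : Sy (m * (n - m) + m) (kap n m) := by
  cases m with
  | zero => simp [Sy, kap]
  | succ m =>
    obtain ⟨a, rfl⟩ : ∃ a, n = m + a + 1 := ⟨n - (m+1), by omega⟩
    have h1 := gauss_sy (m+a) m (by omega)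
    have h2 := gauss_sy (m+a+1) (m+1) (by omega)
    have hp := gauss_pascal (m+a) m (by omega)
    have hg : gauss (m+a+1) (m+1) = gauss (m+a) m + X ^ (m + 1) * gauss (m+a) (m+1) := by rw [gauss]
    have e1 : m + a - m = a := by omega
    have e2 : m + a + 1 - (m + 1) = a := by omega
    rw [e1] at h1 hp
    rw [e2] at h2 ⊢
    have d1 : (m+1) * a + (m+1) = (m+a+1) + m * a := by ring
    have d2 : (m+1) * a + (m+1) = (m+1) + (m+1) * a := by ring
    simp only [kap, Nat.add_sub_cancel]
    constructor
    · refine natDegree_add_le_of_degree_le ?_ ?_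
      · rw [d1]; exact h1.1.trans (by omega)
      · rw [d2]; exact natDegree_shift _ _ _ h2.1
    · rw [reflect_add]
      conv_lhs =>
        congr
        · rw [d1, reflect_up _ _ _ h1.1, h1.2]
        · rw [d2, reflect_down _ _ _ h2.1, h2.2]
      have e : (X : Polynomial ℤ) ^ (m+a+1) = X ^ (m+1) * X ^ a := by ring
      rw [e]
      linear_combination hg - X^(m+1) * hp

/-- For `n ≥ 1` and `0 ≤ m ≤ n`, the `q`-Kaplansky number
`K_q(n,m)` is a polynomial with nonnegative coefficients, of degree
`m(n-m)+m`, and it is symmetric about its degree. -/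
theorem kaplansky_nonneg_degree_symmetric (n m : ℕ) (hn : 1 ≤ n) (hmn : m ≤ n) :
    (∀ i, 0 ≤ (kap n m).coeff i) ∧
    (kap n m).natDegree = m * (n - m) + m ∧
    (∀ i ≤ m * (n - m) + m,
      (kap n m).coeff i = (kap n m).coeff (m * (n - m) + m - i)) := by
  have hs := kap_sy n m hmn
  have hsym : ∀ i ≤ m * (n - m) + m,
      (kap n m).coeff i = (kap n m).coeff (m * (n - m) + m - i) := by
    intro i hi
    conv_lhs => rw [← hs.2]
    rw [coeff_reflect, revAt_le hi]
  refine ⟨?_, ?_, hsym⟩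
  · intro i
    cases m with
    | zero => simp only [kap, coeff_one]; split_ifs <;> simp
    | succ m =>
      simp only [kap, coeff_add, coeff_X_pow_mul']
      have h1 := gauss_nonneg (n-1) m i
      split_ifs
      · have h2 := gauss_nonneg n (m+1) (i - (m+1))
        omega
      · omega
  · refine le_antisymm hs.1 (le_natDegree_of_ne_zero ?_)
    have h0 := hsym 0 (by omega)
    rw [Nat.sub_zero] at h0
    rw [← h0]
    cases m with
    | zero => simp [kap]
    | succ m => simp [kap, coeff_X_pow_mul', gauss_coeff_zero (n-1) m (by omega)]
end
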